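/- For every e ∈ (0,4) with e ≠ 2, the boundary value g₊(e; x) = lim_{ε→0⁺} g(e + iε; x) of the lattice Green's function tends to zero as the lattice site goes to infinity: g₊(e; x) → 0 as |x| → ∞, x ∈ ℤ². -/

import Mathlib

open MeasureTheory Real Complex

/-- The lattice Green's function of the 2D discrete Laplacian:
`g(z; x₁, x₂) = (2π)⁻² ∫_{[-π,π]²} e^{-i(k₁x₁+k₂x₂)} / (ω(k) - z) dk`. -/
noncomputable def latticeGreen (z : ℂ) (x₁ x₂ : ℤ) : ℂ :=
  ((2 * Real.pi) ^ 2)⁻¹ •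
    ∫ k in Set.Icc ((-Real.pi, -Real.pi) : ℝ × ℝ) ((Real.pi, Real.pi) : ℝ × ℝ),
      Complex.exp (-Complex.I * ((k.1 : ℂ) * (x₁ : ℂ) + (k.2 : ℂ) * (x₂ : ℂ))) /
        (((2 - Real.cos k.1 - Real.cos k.2 : ℝ) : ℂ) - z)

/-! ### The van der Corput lemma -/

/-- First-derivative van der Corput estimate. -/
theorem norm_integral_exp_I_le_of_deriv_ge {f f' f'' : ℝ → ℝ} {a b c : ℝ} (hab : a ≤ b) (hc : 0 < c)
    (hf : ∀ x ∈ Set.Icc a b, HasDerivAt f (f' x) x)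
    (hf' : ∀ x ∈ Set.Icc a b, HasDerivAt f' (f'' x) x)
    (hcont : ContinuousOn f'' (Set.Icc a b))
    (hnn : ∀ x ∈ Set.Icc a b, 0 ≤ f'' x) (hle : ∀ x ∈ Set.Icc a b, c ≤ f' x) :
    ‖∫ x in a..b, Complex.exp (Complex.I * (f x : ℂ))‖ ≤ 3 / c := by
  have hpos : ∀ x ∈ Set.Icc a b, 0 < f' x := fun x hx => hc.trans_le (hle x hx)
  have huIcc : Set.uIcc a b = Set.Icc a b := Set.uIcc_of_le hab
  have hcf : ContinuousOn f (Set.Icc a b) := fun x hx => (hf x hx).continuousAt.continuousWithinAt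
  have hcf' : ContinuousOn f' (Set.Icc a b) :=
    fun x hx => (hf' x hx).continuousAt.continuousWithinAt
  have hdinv : ∀ x ∈ Set.Icc a b, HasDerivAt (fun x => (f' x)⁻¹) (-f'' x / f' x ^ 2) x :=
    fun x hx => (hf' x hx).inv (hpos x hx).ne'
  have hcinv : ContinuousOn (fun x => -f'' x / f' x ^ 2) (Set.Icc a b) :=
    hcont.neg.div (hcf'.pow 2) fun x hx => pow_ne_zero _ (hpos x hx).ne'
  have hdexp : ∀ x ∈ Set.Icc a b, HasDerivAt (fun x : ℝ => Complex.exp (Complex.I * (f x : ℂ)))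
      (Complex.exp (Complex.I * (f x : ℂ)) * (Complex.I * (f' x : ℂ))) x :=
    fun x hx => (((hf x hx).ofReal_comp).const_mul Complex.I).cexp
  have hparts := intervalIntegral.integral_mul_deriv_eq_deriv_mul
    (u := fun x => (((f' x)⁻¹ : ℝ) : ℂ)) (u' := fun x => ((-f'' x / f' x ^ 2 : ℝ) : ℂ))
    (v := fun x : ℝ => Complex.exp (Complex.I * (f x : ℂ)))
    (v' := fun x => Complex.exp (Complex.I * (f x : ℂ)) * (Complex.I * (f' x : ℂ)))
    (a := a) (b := b)
    (fun x hx => (hdinv x (huIcc ▸ hx)).ofReal_comp) (fun x hx => hdexp x (huIcc ▸ hx))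
    (by
      apply ContinuousOn.intervalIntegrable
      rw [huIcc]
      exact Complex.continuous_ofReal.comp_continuousOn hcinv)
    (by
      apply ContinuousOn.intervalIntegrable
      rw [huIcc]
      have h1 := Complex.continuous_ofReal.comp_continuousOn hcf
      have h2 := Complex.continuous_ofReal.comp_continuousOn hcf'
      exact (Complex.continuous_exp.comp_continuousOn (continuousOn_const.mul h1)).mul
        (continuousOn_const.mul h2))
  have hlhs : ∫ x in a..b, (((f' x)⁻¹ : ℝ) : ℂ) *
      (Complex.exp (Complex.I * (f x : ℂ)) * (Complex.I * (f' x : ℂ))) =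
      Complex.I * ∫ x in a..b, Complex.exp (Complex.I * (f x : ℂ)) := by
    rw [← intervalIntegral.integral_const_mul]
    apply intervalIntegral.integral_congr
    intro x hx
    have : (f' x : ℂ) ≠ 0 := by exact_mod_cast (hpos x (huIcc ▸ hx)).ne'
    simp only [Complex.ofReal_inv]
    field_simp
  rw [hlhs] at hparts
  have hnexp : ∀ x, ‖Complex.exp (Complex.I * (f x : ℂ))‖ = 1 := fun x =>
    Complex.norm_exp_I_mul_ofReal _
  have hbd : ∀ x ∈ Set.Icc a b, (f' x)⁻¹ ≤ c⁻¹ := fun x hx => inv_anti₀ hc (hle x hx)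
  have hb : b ∈ Set.Icc a b := Set.right_mem_Icc.2 hab
  have ha : a ∈ Set.Icc a b := Set.left_mem_Icc.2 hab
  have hint : ‖∫ x in a..b, ((-f'' x / f' x ^ 2 : ℝ) : ℂ) * Complex.exp (Complex.I * (f x : ℂ))‖
      ≤ c⁻¹ := by
    have h1 : ∫ x in a..b, -(-f'' x / f' x ^ 2) = -((f' b)⁻¹ - (f' a)⁻¹) := by
      rw [intervalIntegral.integral_neg, intervalIntegral.integral_eq_sub_of_hasDerivAt
        (f := fun x => (f' x)⁻¹) (fun x hx => hdinv x (huIcc ▸ hx))]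
      apply ContinuousOn.intervalIntegrable
      rwa [huIcc]
    have h2 : ‖∫ x in a..b, ((-f'' x / f' x ^ 2 : ℝ) : ℂ) * Complex.exp (Complex.I * (f x : ℂ))‖
        ≤ ∫ x in a..b, -(-f'' x / f' x ^ 2) := by
      apply intervalIntegral.norm_integral_le_of_norm_le hab
      · refine Filter.Eventually.of_forall fun x hx => ?_
        rw [norm_mul, hnexp, mul_one, Complex.norm_real, Real.norm_eq_abs, abs_of_nonpos]
        have := hnn x (Set.Ioc_subset_Icc_self hx)
        rw [neg_div]
        have : 0 ≤ f'' x / f' x ^ 2 := by positivity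
        linarith
      · apply ContinuousOn.intervalIntegrable
        rw [huIcc]
        exact hcinv.neg
    have := hbd a ha
    have := inv_pos.2 (hpos b hb)
    linarith
  have hnorm : ‖∫ x in a..b, Complex.exp (Complex.I * (f x : ℂ))‖ =
      ‖Complex.I * ∫ x in a..b, Complex.exp (Complex.I * (f x : ℂ))‖ := by simp
  rw [hnorm, hparts]
  refine (norm_sub_le _ _).trans ?_
  have h3 := norm_sub_le ((((f' b)⁻¹ : ℝ) : ℂ) * Complex.exp (Complex.I * (f b : ℂ)))
    ((((f' a)⁻¹ : ℝ) : ℂ) * Complex.exp (Complex.I * (f a : ℂ)))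
  rw [norm_mul, norm_mul, hnexp, hnexp, mul_one, mul_one, Complex.norm_real, Complex.norm_real,
    Real.norm_of_nonneg (inv_pos.2 (hpos b hb)).le,
    Real.norm_of_nonneg (inv_pos.2 (hpos a ha)).le] at h3
  have := hbd a ha
  have := hbd b hb
  have : 3 / c = 3 * c⁻¹ := div_eq_mul_inv _ _
  linarith

/-- Second-derivative van der Corput estimate on an interval where the phase is increasing. -/
theorem norm_integral_exp_I_le_of_deriv_nonneg {f f' f'' : ℝ → ℝ} {a b r : ℝ} (hab : a ≤ b)
    (hr : 0 < r)
    (hf : ∀ x ∈ Set.Icc a b, HasDerivAt f (f' x) x)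
    (hf' : ∀ x ∈ Set.Icc a b, HasDerivAt f' (f'' x) x)
    (hcont : ContinuousOn f'' (Set.Icc a b))
    (hle : ∀ x ∈ Set.Icc a b, r ≤ f'' x) (ha : 0 ≤ f' a) :
    ‖∫ x in a..b, Complex.exp (Complex.I * (f x : ℂ))‖ ≤ 4 / √r := by
  have hs : 0 < √r := Real.sqrt_pos.2 hr
  have hss : √r * √r = r := Real.mul_self_sqrt hr.le
  have hnexp : ∀ x, ‖Complex.exp (Complex.I * (f x : ℂ))‖ ≤ 1 := fun x =>
    (Complex.norm_exp_I_mul_ofReal _).le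
  have hshort : ∀ t, a ≤ t →
      ‖∫ x in a..t, Complex.exp (Complex.I * (f x : ℂ))‖ ≤ t - a := fun t ht => by
    have := intervalIntegral.norm_integral_le_of_norm_le_const (a := a) (b := t)
      (f := fun x : ℝ => Complex.exp (Complex.I * (f x : ℂ))) (C := 1) (fun x _ => hnexp x)
    rwa [one_mul, abs_of_nonneg (by linarith)] at this
  have h41 : 4 / √r = 1 / √r + 3 / √r := by ring
  have h3 : 0 < 3 / √r := by positivity
  rcases le_total b (a + 1 / √r) with hb | hb
  · have := hshort b hab
    linarith
  · have had : a ≤ a + 1 / √r := by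
      have : 0 < 1 / √r := by positivity
      linarith
    have hsub : Set.Icc (a + 1 / √r) b ⊆ Set.Icc a b := Set.Icc_subset_Icc_left had
    have hgrow : ∀ x ∈ Set.Icc a b, r * (x - a) ≤ f' x := by
      intro x hx
      have := (convex_Icc a b).mul_sub_le_image_sub_of_le_deriv (f := f') (C := r)
        (fun y hy => (hf' y hy).continuousAt.continuousWithinAt)
        (fun y hy => (hf' y (interior_subset hy)).differentiableAt.differentiableWithinAt)
        (fun y hy => by
          rw [(hf' y (interior_subset hy)).deriv]
          exact hle y (interior_subset hy)) a ⟨le_rfl, hab⟩ x hx hx.1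
      linarith
    have hmain := norm_integral_exp_I_le_of_deriv_ge (c := √r) hb hs
      (fun x hx => hf x (hsub hx)) (fun x hx => hf' x (hsub hx)) (hcont.mono hsub)
      (fun x hx => hr.le.trans (hle x (hsub hx)))
      (fun x hx => by
        refine le_trans ?_ (hgrow x (hsub hx))
        have h1 : 1 / √r ≤ x - a := by linarith [hx.1]
        calc √r = r * (1 / √r) := by
              rw [mul_one_div, eq_div_iff hs.ne', hss]
          _ ≤ r * (x - a) := by gcongr)
    have hint : ∀ s t, s ∈ Set.Icc a b → t ∈ Set.Icc a b → IntervalIntegrable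
        (fun x : ℝ => Complex.exp (Complex.I * (f x : ℂ))) volume s t := by
      intro s t hs ht
      apply ContinuousOn.intervalIntegrable
      have hcf : ContinuousOn f (Set.Icc a b) :=
        fun x hx => (hf x hx).continuousAt.continuousWithinAt
      have h1 := Complex.continuous_ofReal.comp_continuousOn hcf
      exact (Complex.continuous_exp.comp_continuousOn (continuousOn_const.mul h1)).mono
        (Set.ordConnected_Icc.uIcc_subset hs ht)
    rw [← intervalIntegral.integral_add_adjacent_intervals (b := a + 1 / √r)
      (hint _ _ ⟨le_rfl, hab⟩ ⟨had, hb⟩) (hint _ _ ⟨had, hb⟩ ⟨hab, le_rfl⟩)]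
    have := hshort (a + 1 / √r) had
    refine (norm_add_le _ _).trans ?_
    linarith

/-- Second-derivative van der Corput estimate. -/
theorem norm_integral_exp_I_le_of_second_deriv_ge {f f' f'' : ℝ → ℝ} {a b r : ℝ} (hab : a ≤ b)
    (hr : 0 < r)
    (hf : ∀ x ∈ Set.Icc a b, HasDerivAt f (f' x) x)
    (hf' : ∀ x ∈ Set.Icc a b, HasDerivAt f' (f'' x) x)
    (hcont : ContinuousOn f'' (Set.Icc a b))
    (hle : ∀ x ∈ Set.Icc a b, r ≤ f'' x) :
    ‖∫ x in a..b, Complex.exp (Complex.I * (f x : ℂ))‖ ≤ 8 / √r := by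
  have h48 : 8 / √r = 4 / √r + 4 / √r := by ring
  have h4 : 0 < 4 / √r := by have := Real.sqrt_pos.2 hr; positivity
  have hright : ∀ t ∈ Set.Icc a b, 0 ≤ f' t →
      ‖∫ x in t..b, Complex.exp (Complex.I * (f x : ℂ))‖ ≤ 4 / √r := fun t ht h0 => by
    have hsub : Set.Icc t b ⊆ Set.Icc a b := Set.Icc_subset_Icc_left ht.1
    exact norm_integral_exp_I_le_of_deriv_nonneg ht.2 hr (fun x hx => hf x (hsub hx))
      (fun x hx => hf' x (hsub hx)) (hcont.mono hsub) (fun x hx => hle x (hsub hx)) h0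
  have hleft : ∀ t ∈ Set.Icc a b, f' t ≤ 0 →
      ‖∫ x in a..t, Complex.exp (Complex.I * (f x : ℂ))‖ ≤ 4 / √r := fun t ht h0 => by
    have hmem : ∀ x ∈ Set.Icc (-t) (-a), -x ∈ Set.Icc a b := fun x hx =>
      ⟨by linarith [hx.2], by linarith [hx.1, ht.2]⟩
    have := norm_integral_exp_I_le_of_deriv_nonneg (f := fun x => f (-x)) (f' := fun x => -f' (-x))
      (f'' := fun x => f'' (-x)) (a := -t) (b := -a) (by linarith [ht.1]) hr
      (fun x hx => by
        simpa [Function.comp_def] using (hf (-x) (hmem x hx)).scomp x (hasDerivAt_neg x))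
      (fun x hx => by
        simpa [Function.comp_def, Pi.neg_def] using
          ((hf' (-x) (hmem x hx)).scomp x (hasDerivAt_neg x)).neg)
      (hcont.comp continuous_neg.continuousOn hmem)
      (fun x hx => hle _ (hmem x hx)) (by simpa using h0)
    rw [intervalIntegral.integral_comp_neg (fun x : ℝ => Complex.exp (Complex.I * (f x : ℂ)))] at this
    simpa using this
  by_cases ha : 0 ≤ f' a
  · linarith [hright a ⟨le_rfl, hab⟩ ha]
  by_cases hb : f' b ≤ 0
  · linarith [hleft b ⟨hab, le_rfl⟩ hb]
  push Not at ha hb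
  obtain ⟨t, ht, ht0⟩ := intermediate_value_Icc hab
    (fun x hx => (hf' x hx).continuousAt.continuousWithinAt) (show (0 : ℝ) ∈ Set.Icc _ _ from
      ⟨ha.le, hb.le⟩)
  have hcf : ContinuousOn (fun x : ℝ => Complex.exp (Complex.I * (f x : ℂ))) (Set.Icc a b) :=
    Complex.continuous_exp.comp_continuousOn (continuousOn_const.mul
      (Complex.continuous_ofReal.comp_continuousOn
        (fun x hx => (hf x hx).continuousAt.continuousWithinAt)))
  rw [← intervalIntegral.integral_add_adjacent_intervals (b := t)
    (hcf.mono (Set.ordConnected_Icc.uIcc_subset ⟨le_rfl, hab⟩ ht)).intervalIntegrable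
    (hcf.mono (Set.ordConnected_Icc.uIcc_subset ht ⟨hab, le_rfl⟩)).intervalIntegrable]
  refine (norm_add_le _ _).trans ?_
  linarith [hright t ht ht0.ge, hleft t ht ht0.le]

/-- Van der Corput estimate with a continuously differentiable amplitude. -/
theorem norm_integral_mul_exp_I_le {f f' f'' A A' : ℝ → ℝ} {a b r : ℝ} (hab : a ≤ b)
    (hr : 0 < r)
    (hf : ∀ x ∈ Set.Icc a b, HasDerivAt f (f' x) x)
    (hf' : ∀ x ∈ Set.Icc a b, HasDerivAt f' (f'' x) x)
    (hcont : ContinuousOn f'' (Set.Icc a b))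
    (hle : ∀ x ∈ Set.Icc a b, r ≤ f'' x)
    (hA : ∀ x ∈ Set.Icc a b, HasDerivAt A (A' x) x) (hA' : ContinuousOn A' (Set.Icc a b)) :
    ‖∫ x in a..b, (A x : ℂ) * Complex.exp (Complex.I * (f x : ℂ))‖ ≤
      (|A b| + ∫ x in a..b, |A' x|) * (8 / √r) := by
  have huIcc : Set.uIcc a b = Set.Icc a b := Set.uIcc_of_le hab
  have hcf : ContinuousOn (fun x : ℝ => Complex.exp (Complex.I * (f x : ℂ))) (Set.Icc a b) :=
    Complex.continuous_exp.comp_continuousOn (continuousOn_const.mul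
      (Complex.continuous_ofReal.comp_continuousOn
        (fun x hx => (hf x hx).continuousAt.continuousWithinAt)))
  set G : ℝ → ℂ := fun t => ∫ x in a..t, Complex.exp (Complex.I * (f x : ℂ)) with hG
  have hGle : ∀ t ∈ Set.Icc a b, ‖G t‖ ≤ 8 / √r := fun t ht => by
    have hsub : Set.Icc a t ⊆ Set.Icc a b := Set.Icc_subset_Icc_right ht.2
    exact norm_integral_exp_I_le_of_second_deriv_ge ht.1 hr (fun x hx => hf x (hsub hx))
      (fun x hx => hf' x (hsub hx)) (hcont.mono hsub) (fun x hx => hle x (hsub hx))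
  have hparts := intervalIntegral.integral_mul_deriv_eq_deriv_mul_of_hasDerivAt
    (u := fun x => (A x : ℂ)) (u' := fun x => (A' x : ℂ)) (v := G)
    (v' := fun x : ℝ => Complex.exp (Complex.I * (f x : ℂ))) (a := a) (b := b)
    (by
      rw [huIcc]
      exact Complex.continuous_ofReal.comp_continuousOn
        (fun x hx => (hA x hx).continuousAt.continuousWithinAt))
    (by
      apply intervalIntegral.continuousOn_primitive_interval
      rw [huIcc]
      exact hcf.integrableOn_Icc)
    (by
      rw [min_eq_left hab, max_eq_right hab]
      exact fun x hx => (hA x (Set.Ioo_subset_Icc_self hx)).ofReal_comp)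
    (by
      rw [min_eq_left hab, max_eq_right hab]
      intro x hx
      have hx' := Set.Ioo_subset_Icc_self hx
      have hnhds : Set.Icc a b ∈ nhds x := Icc_mem_nhds hx.1 hx.2
      refine intervalIntegral.integral_hasDerivAt_right ?_ ?_ (hcf.continuousAt hnhds)
      · apply ContinuousOn.intervalIntegrable
        exact hcf.mono (Set.ordConnected_Icc.uIcc_subset ⟨le_rfl, hab⟩ hx')
      · exact (hcf.mono Set.Ioo_subset_Icc_self).stronglyMeasurableAtFilter isOpen_Ioo x hx)
    (by
      apply ContinuousOn.intervalIntegrable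
      rw [huIcc]
      exact Complex.continuous_ofReal.comp_continuousOn hA')
    (by
      apply ContinuousOn.intervalIntegrable
      rwa [huIcc])
  have hGa : G a = 0 := intervalIntegral.integral_same
  rw [hparts, hGa, mul_zero, sub_zero, add_mul]
  refine (norm_sub_le _ _).trans (add_le_add ?_ ?_)
  · rw [norm_mul, Complex.norm_real, Real.norm_eq_abs]
    exact mul_le_mul_of_nonneg_left (hGle b ⟨hab, le_rfl⟩) (abs_nonneg _)
  · rw [← intervalIntegral.integral_mul_const]
    apply intervalIntegral.norm_integral_le_of_norm_le hab
    · refine Filter.Eventually.of_forall fun x hx => ?_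
      rw [norm_mul, Complex.norm_real, Real.norm_eq_abs]
      exact mul_le_mul_of_nonneg_left (hGle x (Set.Ioc_subset_Icc_self hx)) (abs_nonneg _)
    · apply ContinuousOn.intervalIntegrable
      rw [huIcc]
      exact hA'.abs.mul continuousOn_const

/-! ### The Joukowski parametrisation of the closed upper half plane -/

/-- The continuous square root on the closed upper half plane, with values in the closed first
quadrant. -/
noncomputable def quadrantSqrt (u : ℂ) : ℂ :=
  ⟨√((‖u‖ + u.re) / 2), √((‖u‖ - u.re) / 2)⟩

theorem continuous_quadrantSqrt : Continuous quadrantSqrt := by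
  have : quadrantSqrt = fun u : ℂ =>
      ((√((‖u‖ + u.re) / 2) : ℝ) : ℂ) + ((√((‖u‖ - u.re) / 2) : ℝ) : ℂ) * Complex.I := by
    ext u
    exact Complex.mk_eq_add_mul_I _ _
  rw [this]
  fun_prop

theorem quadrantSqrt_sq {u : ℂ} (hu : 0 ≤ u.im) : quadrantSqrt u ^ 2 = u := by
  have h1 : 0 ≤ (‖u‖ + u.re) / 2 := by linarith [neg_le_of_abs_le (Complex.abs_re_le_norm u)]
  have h2 : 0 ≤ (‖u‖ - u.re) / 2 := by linarith [le_of_abs_le (Complex.abs_re_le_norm u)]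
  have h3 : √((‖u‖ + u.re) / 2) * √((‖u‖ - u.re) / 2) = u.im / 2 := by
    rw [← Real.sqrt_mul h1, Real.sqrt_eq_iff_eq_sq (mul_nonneg h1 h2) (by linarith)]
    have := Complex.sq_norm u
    rw [Complex.normSq_apply] at this
    linear_combination this / 4
  apply Complex.ext
  · simp only [quadrantSqrt, sq, Complex.mul_re]
    rw [Real.mul_self_sqrt h1, Real.mul_self_sqrt h2]
    ring
  · simp only [quadrantSqrt, sq, Complex.mul_im]
    linarith

theorem norm_quadrantSqrt {u : ℂ} (hu : 0 ≤ u.im) : ‖quadrantSqrt u‖ = √‖u‖ := by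
  rw [eq_comm, Real.sqrt_eq_iff_eq_sq (norm_nonneg _) (norm_nonneg _), ← norm_pow,
    quadrantSqrt_sq hu]

/-- The root of `t + t⁻¹ = -2 u` in the closed unit disk. -/
noncomputable def joukowskiRoot (u : ℂ) : ℂ :=
  -(quadrantSqrt (u + 1) - quadrantSqrt (u - 1)) ^ 2 / 2

theorem continuous_joukowskiRoot : Continuous joukowskiRoot := by
  have := continuous_quadrantSqrt
  unfold joukowskiRoot
  fun_prop

/-- The density `1 / √(u² - 1)` on the closed upper half plane. -/
noncomputable def joukowskiDensity (u : ℂ) : ℂ :=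
  (quadrantSqrt (u + 1) * quadrantSqrt (u - 1))⁻¹

theorem quadrantSqrt_sub_mul_add {u : ℂ} (hu : 0 ≤ u.im) :
    (quadrantSqrt (u + 1) - quadrantSqrt (u - 1)) *
      (quadrantSqrt (u + 1) + quadrantSqrt (u - 1)) = 2 := by
  have h1 := quadrantSqrt_sq (u := u + 1) (by simpa using hu)
  have h2 := quadrantSqrt_sq (u := u - 1) (by simpa using hu)
  linear_combination h1 - h2

theorem norm_sub_sq_eq (a b : ℂ) :
    ‖a - b‖ ^ 2 + 4 * (a.re * b.re + a.im * b.im) = ‖a + b‖ ^ 2 := by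
  rw [Complex.sq_norm, Complex.sq_norm, Complex.normSq_apply, Complex.normSq_apply]
  simp
  ring

theorem norm_joukowskiRoot (u : ℂ) : ‖joukowskiRoot u‖ =
    ‖quadrantSqrt (u + 1) - quadrantSqrt (u - 1)‖ ^ 2 / 2 := by
  simp [joukowskiRoot]

theorem norm_joukowskiRoot_le_one {u : ℂ} (hu : 0 ≤ u.im) : ‖joukowskiRoot u‖ ≤ 1 := by
  rw [norm_joukowskiRoot]
  set a := quadrantSqrt (u + 1)
  set b := quadrantSqrt (u - 1)
  have h := congrArg norm (quadrantSqrt_sub_mul_add hu)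
  rw [norm_mul, Complex.norm_ofNat] at h
  have h2 := norm_sub_sq_eq a b
  have h3 : 0 ≤ a.re * b.re + a.im * b.im :=
    add_nonneg (mul_nonneg (Real.sqrt_nonneg _) (Real.sqrt_nonneg _))
      (mul_nonneg (Real.sqrt_nonneg _) (Real.sqrt_nonneg _))
  have h4 : ‖a - b‖ ≤ ‖a + b‖ := by
    apply le_of_sq_le_sq _ (norm_nonneg _)
    linarith
  have := mul_le_mul_of_nonneg_left h4 (norm_nonneg (a - b))
  nlinarith

theorem norm_joukowskiRoot_lt_one {u : ℂ} (hu : 0 ≤ u.im) (h : 0 < u.im ∨ 1 < |u.re|) :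
    ‖joukowskiRoot u‖ < 1 := by
  rw [norm_joukowskiRoot]
  set a := quadrantSqrt (u + 1) with ha
  set b := quadrantSqrt (u - 1) with hb
  have hmul := congrArg norm (quadrantSqrt_sub_mul_add hu)
  rw [norm_mul, Complex.norm_ofNat] at hmul
  have h2 := norm_sub_sq_eq a b
  have hre : ∀ w : ℂ, 0 < w.im ∨ 0 < w.re → 0 < (quadrantSqrt w).re := by
    intro w hw
    apply Real.sqrt_pos.2
    rcases hw with hw | hw
    · have := Complex.abs_re_lt_norm.2 hw.ne'
      linarith [neg_lt_of_abs_lt this]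
    · linarith [norm_nonneg w]
  have him : ∀ w : ℂ, 0 < w.im ∨ w.re < 0 → 0 < (quadrantSqrt w).im := by
    intro w hw
    apply Real.sqrt_pos.2
    rcases hw with hw | hw
    · have := Complex.abs_re_lt_norm.2 hw.ne'
      linarith [lt_of_abs_lt this]
    · linarith [norm_nonneg w]
  have hnre : ∀ w : ℂ, 0 ≤ (quadrantSqrt w).re := fun w => Real.sqrt_nonneg _
  have hnim : ∀ w : ℂ, 0 ≤ (quadrantSqrt w).im := fun w => Real.sqrt_nonneg _
  have h3 : 0 < a.re * b.re + a.im * b.im := by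
    have hpos : (0 < u.im ∨ 1 < u.re) ∨ u.re < -1 := by
      rcases h with h | h
      · exact Or.inl (Or.inl h)
      · rcases lt_abs.1 h with h | h
        · exact Or.inl (Or.inr h)
        · exact Or.inr (by linarith)
    rcases hpos with h | h
    · refine add_pos_of_pos_of_nonneg (mul_pos (hre _ ?_) (hre _ ?_)) (mul_nonneg (hnim _) (hnim _))
      · simp only [Complex.add_im, Complex.one_im, add_zero, Complex.add_re, Complex.one_re]
        exact h.imp_right fun h => by linarith
      · simp only [Complex.sub_im, Complex.one_im, sub_zero, Complex.sub_re, Complex.one_re]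
        exact h.imp_right fun h => by linarith
    · refine add_pos_of_nonneg_of_pos (mul_nonneg (hnre _) (hnre _)) (mul_pos (him _ ?_) (him _ ?_))
      · right
        simp only [Complex.add_re, Complex.one_re]
        linarith
      · right
        simp only [Complex.sub_re, Complex.one_re]
        linarith
  have h4 : ‖a - b‖ < ‖a + b‖ := by
    apply lt_of_pow_lt_pow_left₀ 2 (norm_nonneg _)
    linarith
  have h5 : 0 < ‖a - b‖ := by
    rcases (norm_nonneg (a - b)).eq_or_lt with h | h
    · rw [← h] at hmul
      norm_num at hmul
    · exact h
  have := mul_lt_mul_of_pos_left h4 h5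
  nlinarith

/-- On the upper half plane, `1 / (u + cos k)` is a Poisson-type kernel. -/
theorem inv_add_cos_eq {u : ℂ} (hu : 0 < u.im) (k : ℝ) :
    (u + (Real.cos k : ℂ))⁻¹ = joukowskiDensity u *
      ((1 - joukowskiRoot u * Complex.exp (Complex.I * k))⁻¹ +
        joukowskiRoot u * Complex.exp (-(Complex.I * k)) *
          (1 - joukowskiRoot u * Complex.exp (-(Complex.I * k)))⁻¹) := by
  have hlt := norm_joukowskiRoot_lt_one hu.le (Or.inl hu)
  have hne : ∀ w : ℂ, ‖w‖ = 1 → 1 - joukowskiRoot u * w ≠ 0 := by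
    intro w hw h
    have h1 : joukowskiRoot u * w = 1 := (sub_eq_zero.1 h).symm
    have := congrArg norm h1
    rw [norm_mul, hw, norm_one] at this
    linarith
  have he1 : ‖Complex.exp (Complex.I * k)‖ = 1 := Complex.norm_exp_I_mul_ofReal k
  have he2 : ‖Complex.exp (-(Complex.I * k))‖ = 1 := by
    have := Complex.norm_exp_I_mul_ofReal (-k)
    rw [← this]; congr 2; push_cast; ring
  have hn1 := hne _ he1
  have hn2 := hne _ he2
  have hE : Complex.exp (Complex.I * k) * Complex.exp (-(Complex.I * k)) = 1 := by
    rw [← Complex.exp_add, add_neg_cancel, Complex.exp_zero]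
  have hcos : (Real.cos k : ℂ) =
      (Complex.exp (Complex.I * k) + Complex.exp (-(Complex.I * k))) / 2 := by
    rw [Complex.ofReal_cos, Complex.cos]; congr 3 <;> ring_nf
  have hs1 := quadrantSqrt_sq (u := u + 1) (by simpa using hu.le)
  have hs2 := quadrantSqrt_sq (u := u - 1) (by simpa using hu.le)
  have hu1 : u + 1 ≠ 0 := fun h => by
    have := congrArg Complex.im h
    simp at this
    exact hu.ne' this
  have hu2 : u - 1 ≠ 0 := fun h => by
    have := congrArg Complex.im h
    simp at this
    exact hu.ne' this
  have hu3 : u + (Real.cos k : ℂ) ≠ 0 := fun h => by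
    have := congrArg Complex.im h
    simp only [Complex.add_im, Complex.ofReal_im, Complex.zero_im, add_zero] at this
    exact hu.ne' this
  set E := Complex.exp (Complex.I * k)
  set E' := Complex.exp (-(Complex.I * k))
  set c : ℂ := (Real.cos k : ℂ)
  unfold joukowskiDensity
  have hL : joukowskiRoot u =
    -(quadrantSqrt (u + 1) - quadrantSqrt (u - 1)) ^ 2 / 2 := rfl
  set L := joukowskiRoot u
  set a := quadrantSqrt (u + 1)
  set b := quadrantSqrt (u - 1)
  have ha : a ≠ 0 := fun h => hu1 (by rw [← hs1, h]; ring)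
  have hb : b ≠ 0 := fun h => hu2 (by rw [← hs2, h]; ring)
  have hLu : L = a * b - u := by linear_combination hL - (hs1 + hs2) / 2
  have hab : (a * b) ^ 2 = u ^ 2 - 1 := by
    rw [mul_pow, hs1, hs2]; ring
  have key : (a * b) * ((1 - L * E) * (1 - L * E')) = (1 - L ^ 2) * (u + c) := by
    have h1 : (1 - L * E) * (1 - L * E') = 1 - 2 * L * c + L ^ 2 := by
      linear_combination L ^ 2 * hE + 2 * L * hcos
    rw [h1, hLu]
    generalize a * b = s at *
    linear_combination (s - c - u) * hab
  have h2 : (1 - L * E)⁻¹ + L * E' * (1 - L * E')⁻¹ =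
      (1 - L ^ 2) / ((1 - L * E) * (1 - L * E')) := by
    field_simp
    linear_combination -L ^ 2 * hE
  rw [h2]
  field_simp
  linear_combination key

/-! ### Integration over one momentum variable -/

theorem integral_exp_I_int_mul (p : ℤ) :
    ∫ k in (-Real.pi)..Real.pi, Complex.exp (Complex.I * p * (k : ℝ)) =
      if p = 0 then 2 * (Real.pi : ℂ) else 0 := by
  split_ifs with h
  · subst h
    simp
    ring
  · have hc : Complex.I * (p : ℂ) ≠ 0 := mul_ne_zero Complex.I_ne_zero (by exact_mod_cast h)
    rw [integral_exp_mul_complex hc]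
    have : Complex.exp (Complex.I * p * (Real.pi : ℝ)) =
        Complex.exp (Complex.I * p * ((-Real.pi : ℝ) : ℂ)) := by
      rw [Complex.exp_eq_exp_iff_exists_int]
      exact ⟨p, by push_cast; ring⟩
    rw [this, sub_self, zero_div]

theorem one_sub_mul_exp_ne_zero {L : ℂ} (hL : ‖L‖ < 1) (t : ℝ) :
    1 - L * Complex.exp (Complex.I * t) ≠ 0 := by
  intro h
  have h1 := congrArg norm (sub_eq_zero.1 h).symm
  rw [norm_mul, Complex.norm_exp_I_mul_ofReal, norm_one] at h1
  linarith

theorem integral_exp_mul_geometric {L : ℂ} (hL : ‖L‖ < 1) (n : ℤ) :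
    ∫ k in (-Real.pi)..Real.pi,
      Complex.exp (Complex.I * n * (k : ℝ)) * (1 - L * Complex.exp (Complex.I * (k : ℝ)))⁻¹ =
      if n ≤ 0 then 2 * (Real.pi : ℂ) * L ^ n.natAbs else 0 := by
  have hE : ∀ k : ℝ, ‖Complex.exp (Complex.I * n * k)‖ = 1 := fun k => by
    rw [← Complex.norm_exp_I_mul_ofReal (n * k)]; congr 2; push_cast; ring
  have hsum : HasSum (fun j : ℕ => ∫ k in (-Real.pi)..Real.pi,
      Complex.exp (Complex.I * n * (k : ℝ)) * (L * Complex.exp (Complex.I * (k : ℝ))) ^ j)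
      (∫ k in (-Real.pi)..Real.pi,
      Complex.exp (Complex.I * n * (k : ℝ)) *
        (1 - L * Complex.exp (Complex.I * (k : ℝ)))⁻¹) := by
    refine intervalIntegral.hasSum_integral_of_dominated_convergence (fun j _ => ‖L‖ ^ j)
      (fun j => ?_) (fun j => ?_) ?_ ?_ ?_
    · apply Continuous.aestronglyMeasurable
      fun_prop
    · refine Filter.Eventually.of_forall fun k _ => ?_
      rw [norm_mul, hE, norm_pow, norm_mul, Complex.norm_exp_I_mul_ofReal, mul_one, one_mul]
    · exact Filter.Eventually.of_forall fun k _ =>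
        summable_geometric_of_lt_one (norm_nonneg _) hL
    · exact intervalIntegrable_const
    · refine Filter.Eventually.of_forall fun k _ => ?_
      apply HasSum.mul_left
      apply hasSum_geometric_of_norm_lt_one
      rwa [norm_mul, Complex.norm_exp_I_mul_ofReal, mul_one]
  have hterm : ∀ j : ℕ, ∫ k in (-Real.pi)..Real.pi,
      Complex.exp (Complex.I * n * (k : ℝ)) * (L * Complex.exp (Complex.I * (k : ℝ))) ^ j =
      if n + j = 0 then 2 * (Real.pi : ℂ) * L ^ j else 0 := by
    intro j
    have h1 : ∀ k : ℝ, Complex.exp (Complex.I * n * k) * (L * Complex.exp (Complex.I * k)) ^ j =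
        L ^ j * Complex.exp (Complex.I * ((n + j : ℤ) : ℂ) * k) := by
      intro k
      rw [mul_pow, ← Complex.exp_nat_mul, mul_left_comm, ← Complex.exp_add]
      congr 2
      push_cast
      ring
    simp_rw [h1]
    rw [intervalIntegral.integral_const_mul, integral_exp_I_int_mul]
    split_ifs <;> ring
  simp_rw [hterm] at hsum
  refine hsum.unique ?_
  split_ifs with hn
  · have := hasSum_single (f := fun j : ℕ => if n + j = 0 then 2 * (Real.pi : ℂ) * L ^ j else 0)
      n.natAbs (fun j hj => if_neg (by omega))
    rwa [if_pos (by omega)] at this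
  · have : (fun j : ℕ => if n + j = 0 then 2 * (Real.pi : ℂ) * L ^ j else 0) = fun _ => 0 := by
      ext j
      exact if_neg (by omega)
    rw [this]
    exact hasSum_zero

/-- The one-dimensional lattice Green's function. -/
theorem integral_exp_mul_inv_add_cos {u : ℂ} (hu : 0 < u.im) (n : ℤ) :
    ∫ k in (-Real.pi)..Real.pi,
      Complex.exp (Complex.I * ((-n : ℤ) : ℂ) * (k : ℝ)) * (u + (Real.cos k : ℂ))⁻¹ =
      2 * (Real.pi : ℂ) * (joukowskiRoot u ^ n.natAbs * joukowskiDensity u) := by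
  set L := joukowskiRoot u with hLdef
  have hL : ‖L‖ < 1 := norm_joukowskiRoot_lt_one hu.le (Or.inl hu)
  have hcont : ∀ m : ℤ, Continuous fun k : ℝ => Complex.exp (Complex.I * m * (k : ℝ)) *
      (1 - L * Complex.exp (Complex.I * (k : ℝ)))⁻¹ := fun m => by
    refine Continuous.mul (by fun_prop) (Continuous.inv₀ (by fun_prop) ?_)
    exact fun k => one_sub_mul_exp_ne_zero hL k
  have hsplit : ∀ k : ℝ, Complex.exp (Complex.I * ((-n : ℤ) : ℂ) * k) *
      (u + (Real.cos k : ℂ))⁻¹ = joukowskiDensity u *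
      (Complex.exp (Complex.I * ((-n : ℤ) : ℂ) * k) * (1 - L * Complex.exp (Complex.I * k))⁻¹ +
      L * (Complex.exp (Complex.I * ((n + 1 : ℤ) : ℂ) * ((-k : ℝ) : ℂ)) *
        (1 - L * Complex.exp (Complex.I * ((-k : ℝ) : ℂ)))⁻¹)) := by
    intro k
    rw [inv_add_cos_eq hu]
    have h1 : Complex.exp (Complex.I * ((n + 1 : ℤ) : ℂ) * ((-k : ℝ) : ℂ)) =
        Complex.exp (Complex.I * ((-n : ℤ) : ℂ) * k) * Complex.exp (-(Complex.I * k)) := by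
      rw [← Complex.exp_add]; congr 1; push_cast; ring
    have h2 : Complex.I * ((-k : ℝ) : ℂ) = -(Complex.I * k) := by push_cast; ring
    rw [h1, h2]
    ring
  simp_rw [hsplit]
  rw [intervalIntegral.integral_const_mul, intervalIntegral.integral_add,
    intervalIntegral.integral_const_mul,
    intervalIntegral.integral_comp_neg (fun k : ℝ => Complex.exp (Complex.I * ((n + 1 : ℤ) : ℂ) *
      (k : ℝ)) * (1 - L * Complex.exp (Complex.I * (k : ℝ)))⁻¹), neg_neg,
    integral_exp_mul_geometric hL, integral_exp_mul_geometric hL]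
  · by_cases hn : 0 ≤ n
    · rw [if_pos (by omega), if_neg (by omega), Int.natAbs_neg]
      ring
    · rw [if_neg (by omega), if_pos (by omega)]
      have : n.natAbs = (n + 1).natAbs + 1 := by omega
      rw [this, pow_succ]
      ring
  · exact (hcont _).intervalIntegrable _ _
  · exact (continuous_const.mul ((hcont _).comp continuous_neg)).intervalIntegrable _ _

theorem latticeGreen_swap (z : ℂ) (x₁ x₂ : ℤ) : latticeGreen z x₁ x₂ = latticeGreen z x₂ x₁ := by
  unfold latticeGreen
  congr 1
  rw [← Set.Icc_prod_Icc, Measure.volume_eq_prod, ← setIntegral_prod_swap]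
  congr 1
  ext k
  simp only [Prod.fst_swap, Prod.snd_swap]
  congr 2
  · ring
  · congr 1
    ring

theorem latticeGreen_eq_integral {z : ℂ} (hz : 0 < z.im) (x₁ x₂ : ℤ) :
    latticeGreen z x₁ x₂ = -(2 * (Real.pi : ℂ))⁻¹ * ∫ k in (-Real.pi)..Real.pi,
      Complex.exp (Complex.I * ((-x₁ : ℤ) : ℂ) * (k : ℝ)) *
        (joukowskiRoot ((Real.cos k : ℂ) - 2 + z) ^ x₂.natAbs *
          joukowskiDensity ((Real.cos k : ℂ) - 2 + z)) := by
  have hpi : -Real.pi ≤ Real.pi := by linarith [Real.pi_pos]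
  have him : ∀ a b : ℝ, (((2 - a - b : ℝ) : ℂ) - z) ≠ 0 := fun a b h => by
    have := congrArg Complex.im h
    simp at this
    exact hz.ne' this
  unfold latticeGreen
  rw [← Set.Icc_prod_Icc, Measure.volume_eq_prod, setIntegral_prod]
  · have hinner : ∀ k : ℝ, ∫ y in Set.Icc (-Real.pi) Real.pi,
        Complex.exp (-Complex.I * ((k : ℂ) * (x₁ : ℂ) + (y : ℂ) * (x₂ : ℂ))) /
        (((2 - Real.cos k - Real.cos y : ℝ) : ℂ) - z) =
        -(2 * (Real.pi : ℂ)) * (Complex.exp (Complex.I * ((-x₁ : ℤ) : ℂ) * (k : ℝ)) *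
        (joukowskiRoot ((Real.cos k : ℂ) - 2 + z) ^ x₂.natAbs *
          joukowskiDensity ((Real.cos k : ℂ) - 2 + z))) := by
      intro k
      have hu : 0 < ((Real.cos k : ℂ) - 2 + z).im := by
        simp only [Complex.add_im, Complex.sub_im, Complex.ofReal_im]
        simpa using hz
      have h := integral_exp_mul_inv_add_cos hu x₂
      rw [integral_Icc_eq_integral_Ioc, ← intervalIntegral.integral_of_le hpi]
      have h1 : ∀ y : ℝ, Complex.exp (-Complex.I * ((k : ℂ) * (x₁ : ℂ) + (y : ℂ) * (x₂ : ℂ))) /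
          (((2 - Real.cos k - Real.cos y : ℝ) : ℂ) - z) =
          -Complex.exp (Complex.I * ((-x₁ : ℤ) : ℂ) * (k : ℝ)) *
          (Complex.exp (Complex.I * ((-x₂ : ℤ) : ℂ) * (y : ℝ)) *
            ((Real.cos k : ℂ) - 2 + z + (Real.cos y : ℂ))⁻¹) := by
        intro y
        have h2 : (((2 - Real.cos k - Real.cos y : ℝ) : ℂ) - z) =
            -((Real.cos k : ℂ) - 2 + z + (Real.cos y : ℂ)) := by
          push_cast; ring
        have h3 : Complex.exp (-Complex.I * ((k : ℂ) * (x₁ : ℂ) + (y : ℂ) * (x₂ : ℂ))) =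
            Complex.exp (Complex.I * ((-x₁ : ℤ) : ℂ) * (k : ℝ)) *
            Complex.exp (Complex.I * ((-x₂ : ℤ) : ℂ) * (y : ℝ)) := by
          rw [← Complex.exp_add]; congr 1; push_cast; ring
        rw [h2, h3, div_eq_mul_inv, inv_neg]
        ring
      simp_rw [h1]
      rw [intervalIntegral.integral_const_mul, h]
      ring
    simp only [hinner]
    rw [integral_Icc_eq_integral_Ioc, ← intervalIntegral.integral_of_le hpi,
      intervalIntegral.integral_const_mul, Complex.real_smul]
    have : (Real.pi : ℂ) ≠ 0 := by exact_mod_cast Real.pi_ne_zero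
    push_cast
    field_simp
  · rw [Set.Icc_prod_Icc]
    apply ContinuousOn.integrableOn_compact isCompact_Icc
    apply Continuous.continuousOn
    refine Continuous.div (by fun_prop) (by fun_prop) fun k => him _ _

/-! ### Integrable singularities on the Fermi curve -/

theorem intervalIntegrable_inv_sqrt_abs_sub (t a b : ℝ) :
    IntervalIntegrable (fun x : ℝ => (√|x - t|)⁻¹) volume a b := by
  have h : IntervalIntegrable (fun x : ℝ => (√|x|)⁻¹) volume (a - t) (b - t) := by
    have h1 := (intervalIntegral.intervalIntegrable_cpow' (a := a - t) (b := b - t)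
      (r := ((-(1 / 2) : ℝ) : ℂ)) (by rw [Complex.ofReal_re]; norm_num)).norm
    refine h1.congr fun x _ => ?_
    rw [Complex.norm_cpow_real, Complex.norm_real, Real.norm_eq_abs, Real.rpow_neg (abs_nonneg _),
      Real.sqrt_eq_rpow]
  simpa using h.comp_sub_right t

theorem exists_mul_abs_le_abs_sin {y₀ : ℝ} (h0 : 0 < y₀) (h1 : y₀ < Real.pi) :
    ∃ C > 0, ∀ y, |y| ≤ y₀ → C * |y| ≤ |Real.sin y| := by
  have hpi := Real.pi_pos
  have hd : 0 < Real.pi - y₀ := by linarith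
  refine ⟨2 / Real.pi * ((Real.pi - y₀) / Real.pi), by positivity, fun y hy => ?_⟩
  have key : ∀ y : ℝ, 0 ≤ y → y ≤ y₀ →
      2 / Real.pi * ((Real.pi - y₀) / Real.pi) * y ≤ Real.sin y := by
    intro y hy0 hy1
    rcases le_total y (Real.pi / 2) with h | h
    · refine le_trans ?_ (Real.mul_le_sin hy0 h)
      have : (Real.pi - y₀) / Real.pi ≤ 1 := by rw [div_le_one hpi]; linarith
      have h2 : 0 ≤ 2 / Real.pi * y := by positivity
      nlinarith
    · have h2 := Real.mul_le_sin (x := Real.pi - y) (by linarith) (by linarith)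
      rw [Real.sin_pi_sub] at h2
      refine le_trans ?_ h2
      have h3 : y / Real.pi ≤ 1 := by rw [div_le_one hpi]; linarith
      calc 2 / Real.pi * ((Real.pi - y₀) / Real.pi) * y
          = 2 / Real.pi * ((Real.pi - y₀) * (y / Real.pi)) := by ring
        _ ≤ 2 / Real.pi * ((Real.pi - y₀) * 1) := by gcongr
        _ ≤ 2 / Real.pi * (Real.pi - y) := by rw [mul_one]; gcongr
  refine (key _ (abs_nonneg y) hy).trans ?_
  rcases abs_cases y with ⟨h, _⟩ | ⟨h, _⟩ <;> rw [h]
  · exact le_abs_self _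
  · rw [Real.sin_neg]; exact neg_le_abs _

theorem exists_mul_le_abs_cos_sub_cos {α : ℝ} (h0 : 0 < α) (h1 : α < Real.pi) :
    ∃ C > 0, ∀ k, |k| ≤ Real.pi →
      C * (|k - α| * |k - -α|) ≤ |Real.cos k - Real.cos α| := by
  obtain ⟨C, hC, h⟩ := exists_mul_abs_le_abs_sin (y₀ := (Real.pi + α) / 2)
    (by linarith [Real.pi_pos]) (by linarith)
  refine ⟨C ^ 2 / 2, by positivity, fun k hk => ?_⟩
  obtain ⟨hk1, hk2⟩ := abs_le.1 hk
  have e1 := h ((k + α) / 2) (by rw [abs_le]; constructor <;> linarith)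
  have e2 := h ((k - α) / 2) (by rw [abs_le]; constructor <;> linarith)
  have e3 := mul_le_mul e1 e2 (by positivity) (abs_nonneg _)
  rw [Real.cos_sub_cos, abs_mul, abs_mul, abs_neg, abs_two, sub_neg_eq_add]
  rw [abs_div, abs_div, abs_two] at e3
  linarith

theorem intervalIntegrable_inv_sqrt_abs_cos_sub_cos {α : ℝ} (h0 : 0 < α) (h1 : α < Real.pi) :
    IntervalIntegrable (fun k => (√|Real.cos k - Real.cos α|)⁻¹) volume
      (-Real.pi) Real.pi := by
  obtain ⟨C, hC, h⟩ := exists_mul_le_abs_cos_sub_cos h0 h1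
  have hint := ((intervalIntegrable_inv_sqrt_abs_sub α (-Real.pi) Real.pi).add
    (intervalIntegrable_inv_sqrt_abs_sub (-α) (-Real.pi) Real.pi)).const_mul ((√C)⁻¹ * (√α)⁻¹)
  refine hint.mono_fun' (Measurable.aestronglyMeasurable (by fun_prop)) ?_
  have hae : ∀ᵐ k : ℝ ∂(volume.restrict (Set.uIoc (-Real.pi) Real.pi)), k ∉ ({α, -α} : Set ℝ) :=
    ae_restrict_of_ae ((Set.toFinite _).countable.ae_notMem volume)
  filter_upwards [hae, ae_restrict_mem measurableSet_uIoc] with k hk hk'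
  rw [Set.uIoc_of_le (by linarith [Real.pi_pos])] at hk'
  simp only [Set.mem_insert_iff, Set.mem_singleton_iff, not_or] at hk
  have hp : 0 < |k - α| := abs_pos.2 (sub_ne_zero.2 hk.1)
  have hq : 0 < |k - -α| := abs_pos.2 (sub_ne_zero.2 hk.2)
  have hsum : α ≤ |k - α| + |k - -α| := by
    have h2 := abs_sub (k - -α) (k - α)
    rw [show k - -α - (k - α) = 2 * α by ring, abs_of_pos (by linarith)] at h2
    linarith
  rw [Real.norm_of_nonneg (by positivity)]
  have hk2 := h k (abs_le.2 ⟨hk'.1.le, hk'.2⟩)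
  set p := |k - α|
  set q := |k - -α|
  have hsp := Real.sqrt_pos.2 hp
  have hsq := Real.sqrt_pos.2 hq
  have hsC := Real.sqrt_pos.2 hC
  have hsα := Real.sqrt_pos.2 h0
  have hroot : √α ≤ √p + √q := by
    rw [Real.sqrt_le_left (by positivity)]
    have := Real.sq_sqrt hp.le
    have := Real.sq_sqrt hq.le
    nlinarith [mul_pos hsp hsq]
  calc (√|Real.cos k - Real.cos α|)⁻¹ ≤ (√(C * (p * q)))⁻¹ := by
        apply inv_anti₀ (Real.sqrt_pos.2 (by positivity))
        exact Real.sqrt_le_sqrt hk2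
    _ = (√C)⁻¹ * ((√p)⁻¹ * (√q)⁻¹) := by
        rw [Real.sqrt_mul hC.le, Real.sqrt_mul hp.le, mul_inv, mul_inv]
    _ ≤ (√C)⁻¹ * (√α)⁻¹ * ((√p)⁻¹ + (√q)⁻¹) := by
        rw [mul_assoc]
        refine mul_le_mul_of_nonneg_left ?_ (by positivity)
        rw [← mul_inv, inv_mul_eq_div, inv_eq_one_div, div_le_div_iff₀ (by positivity) hsα]
        have : ((√p)⁻¹ + (√q)⁻¹) * (√p * √q) = √p + √q := by field_simp; ring
        rw [this, one_mul]
        exact hroot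

/-- The modulus of the boundary value of the density `joukowskiDensity` at `cos k - c`. -/
noncomputable def boundaryDensity (c k : ℝ) : ℝ :=
  (√|Real.cos k - c + 1| * √|Real.cos k - c - 1|)⁻¹

theorem boundaryDensity_nonneg (c k : ℝ) : 0 ≤ boundaryDensity c k := by
  unfold boundaryDensity
  positivity

theorem exists_fermi_angle {c : ℝ} (hc : c ≠ 0) (hc2 : |c| < 2) :
    ∃ α, 0 < α ∧ α < Real.pi ∧
      ((0 < c ∧ Real.cos α = c - 1) ∨ (c < 0 ∧ Real.cos α = c + 1)) := by
  obtain ⟨h1, h2⟩ := abs_lt.1 hc2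
  have key : ∀ y : ℝ, -1 < y → y < 1 →
      0 < Real.arccos y ∧ Real.arccos y < Real.pi ∧ Real.cos (Real.arccos y) = y := by
    intro y hy1 hy2
    refine ⟨Real.arccos_pos.2 hy2, lt_of_le_of_ne (Real.arccos_le_pi _) fun h => ?_,
      Real.cos_arccos hy1.le hy2.le⟩
    rw [Real.arccos_eq_pi] at h
    linarith
  rcases hc.lt_or_gt with h | h
  · obtain ⟨h3, h4, h5⟩ := key (c + 1) (by linarith) (by linarith)
    exact ⟨_, h3, h4, Or.inr ⟨h, h5⟩⟩
  · obtain ⟨h3, h4, h5⟩ := key (c - 1) (by linarith) (by linarith)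
    exact ⟨_, h3, h4, Or.inl ⟨h, h5⟩⟩

theorem intervalIntegrable_boundaryDensity {c : ℝ} (hc : c ≠ 0) (hc2 : |c| < 2) :
    IntervalIntegrable (boundaryDensity c) volume (-Real.pi) Real.pi := by
  obtain ⟨α, h0, h1, h⟩ := exists_fermi_angle hc hc2
  refine ((intervalIntegrable_inv_sqrt_abs_cos_sub_cos h0 h1).const_mul ((√|c|)⁻¹)).mono_fun'
    (Measurable.aestronglyMeasurable (by unfold boundaryDensity; fun_prop)) ?_
  refine Filter.Eventually.of_forall fun k => ?_
  simp only
  have hcp : 0 < √|c| := Real.sqrt_pos.2 (abs_pos.2 hc)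
  rw [Real.norm_of_nonneg (boundaryDensity_nonneg c k), boundaryDensity, mul_inv]
  rcases h with ⟨h2, h3⟩ | ⟨h2, h3⟩
  · rw [mul_comm, h3, show Real.cos k - c + 1 = Real.cos k - (c - 1) by ring]
    refine mul_le_mul_of_nonneg_right (inv_anti₀ hcp (Real.sqrt_le_sqrt ?_)) (by positivity)
    rw [abs_of_pos h2, abs_of_neg (by linarith [Real.cos_le_one k])]
    linarith [Real.cos_le_one k]
  · rw [h3, show Real.cos k - c - 1 = Real.cos k - (c + 1) by ring]
    refine mul_le_mul_of_nonneg_right (inv_anti₀ hcp (Real.sqrt_le_sqrt ?_)) (by positivity)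
    rw [abs_of_neg h2, abs_of_pos (by linarith [Real.neg_one_le_cos k])]
    linarith [Real.neg_one_le_cos k]

/-- The momenta are cut by `±α` into intervals on which `cos k - c` lies inside, or outside,
`[-1, 1]`. -/
theorem abs_cos_sub_lt_or_gt {c α : ℝ} (h0 : 0 < α) (h1 : α < Real.pi)
    (h : (0 < c ∧ Real.cos α = c - 1) ∨ (c < 0 ∧ Real.cos α = c + 1)) :
    ((∀ k, |k| < α → |Real.cos k - c| < 1) ∧
      (∀ k, α < |k| → |k| ≤ Real.pi → 1 < |Real.cos k - c|)) ∨
    ((∀ k, |k| < α → 1 < |Real.cos k - c|) ∧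
      (∀ k, α < |k| → |k| ≤ Real.pi → |Real.cos k - c| < 1)) := by
  have hin : ∀ k, |k| < α → Real.cos α < Real.cos k := fun k hk => by
    rw [← Real.cos_abs k]
    exact Real.cos_lt_cos_of_nonneg_of_le_pi (abs_nonneg _) h1.le hk
  have hout : ∀ k, α < |k| → |k| ≤ Real.pi → Real.cos k < Real.cos α := fun k hk hk' => by
    rw [← Real.cos_abs k]
    exact Real.cos_lt_cos_of_nonneg_of_le_pi h0.le hk' hk
  rcases h with ⟨h2, h3⟩ | ⟨h2, h3⟩
  · refine Or.inl ⟨fun k hk => ?_, fun k hk hk' => ?_⟩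
    · have := hin k hk
      rw [abs_lt]
      constructor <;> linarith [Real.cos_le_one k]
    · have := hout k hk hk'
      rw [lt_abs]
      right
      linarith
  · refine Or.inr ⟨fun k hk => ?_, fun k hk hk' => ?_⟩
    · have := hin k hk
      rw [lt_abs]
      left
      linarith
    · have := hout k hk hk'
      rw [abs_lt]
      constructor <;> linarith [Real.neg_one_le_cos k]

/-- The integrand of the boundary value of the lattice Green's function. -/
noncomputable def boundaryIntegrand (c : ℝ) (n : ℕ) (m : ℤ) (k : ℝ) : ℂ :=
  Complex.exp (Complex.I * (m : ℂ) * (k : ℝ)) *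
    (joukowskiRoot ((Real.cos k - c : ℝ) : ℂ) ^ n *
      joukowskiDensity ((Real.cos k - c : ℝ) : ℂ))

theorem norm_exp_I_mul_int_mul (m : ℤ) (k : ℝ) :
    ‖Complex.exp (Complex.I * (m : ℂ) * (k : ℝ))‖ = 1 := by
  rw [← Complex.norm_exp_I_mul_ofReal (m * k)]; congr 2; push_cast; ring

theorem norm_joukowskiDensity {u : ℂ} (hu : 0 ≤ u.im) :
    ‖joukowskiDensity u‖ = (√‖u + 1‖ * √‖u - 1‖)⁻¹ := by
  rw [joukowskiDensity, norm_inv, norm_mul, norm_quadrantSqrt (by simpa using hu),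
    norm_quadrantSqrt (by simpa using hu)]

theorem norm_joukowskiDensity_cos_sub (c k : ℝ) :
    ‖joukowskiDensity ((Real.cos k - c : ℝ) : ℂ)‖ = boundaryDensity c k := by
  have h1 : ((Real.cos k - c : ℝ) : ℂ) + 1 = ((Real.cos k - c + 1 : ℝ) : ℂ) := by push_cast; ring
  have h2 : ((Real.cos k - c : ℝ) : ℂ) - 1 = ((Real.cos k - c - 1 : ℝ) : ℂ) := by push_cast; ring
  rw [norm_joukowskiDensity (Complex.ofReal_im _).ge, boundaryDensity, h1, h2, Complex.norm_real,
    Complex.norm_real, Real.norm_eq_abs, Real.norm_eq_abs]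

theorem measurable_joukowskiDensity : Measurable joukowskiDensity := by
  have := continuous_quadrantSqrt
  have h : Continuous fun u : ℂ => quadrantSqrt (u + 1) * quadrantSqrt (u - 1) := by fun_prop
  exact h.measurable.inv

theorem norm_boundaryIntegrand (c : ℝ) (n : ℕ) (m : ℤ) (k : ℝ) :
    ‖boundaryIntegrand c n m k‖ =
      ‖joukowskiRoot ((Real.cos k - c : ℝ) : ℂ)‖ ^ n * boundaryDensity c k := by
  rw [boundaryIntegrand, norm_mul, norm_exp_I_mul_int_mul, one_mul, norm_mul, norm_pow,
    norm_joukowskiDensity_cos_sub]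

theorem norm_boundaryIntegrand_le (c : ℝ) (n : ℕ) (m : ℤ) (k : ℝ) :
    ‖boundaryIntegrand c n m k‖ ≤ boundaryDensity c k := by
  rw [norm_boundaryIntegrand]
  exact mul_le_of_le_one_left (boundaryDensity_nonneg c k)
    (pow_le_one₀ (norm_nonneg _) (norm_joukowskiRoot_le_one (by simp)))

theorem measurable_boundaryIntegrand (c : ℝ) (n : ℕ) (m : ℤ) :
    Measurable (boundaryIntegrand c n m) := by
  have h1 := continuous_joukowskiRoot.measurable
  have h2 := measurable_joukowskiDensity
  unfold boundaryIntegrand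
  fun_prop

theorem intervalIntegrable_boundaryIntegrand {c p q : ℝ}
    (hD : IntervalIntegrable (boundaryDensity c) volume p q) (n : ℕ) (m : ℤ) :
    IntervalIntegrable (boundaryIntegrand c n m) volume p q :=
  hD.mono_fun' (measurable_boundaryIntegrand c n m).aestronglyMeasurable
    (Filter.Eventually.of_forall fun k => norm_boundaryIntegrand_le c n m k)

open Filter Topology in
theorem tendsto_latticeGreen {e : ℝ} (he : e ∈ Set.Ioo (0 : ℝ) 4) (he2 : e ≠ 2) (x₁ x₂ : ℤ) :
    Tendsto (fun ε : ℝ => latticeGreen ((e : ℂ) + ε * Complex.I) x₁ x₂) (𝓝[>] 0)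
      (𝓝 (-(2 * (Real.pi : ℂ))⁻¹ * ∫ k in (-Real.pi)..Real.pi,
        boundaryIntegrand (2 - e) x₂.natAbs (-x₁) k)) := by
  set c := 2 - e with hcdef
  have hc : c ≠ 0 := fun h => he2 (by linarith)
  have hc2 : |c| < 2 := by rw [abs_lt]; constructor <;> linarith [he.1, he.2]
  have heq : ∀ (ε k : ℝ), (Real.cos k : ℂ) - 2 + ((e : ℂ) + ε * Complex.I) =
      ((Real.cos k - c : ℝ) : ℂ) + ε * Complex.I := fun ε k => by
    rw [hcdef]; push_cast; ring
  have hcongr : ∀ᶠ ε : ℝ in 𝓝[>] 0, -(2 * (Real.pi : ℂ))⁻¹ * ∫ k in (-Real.pi)..Real.pi,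
      Complex.exp (Complex.I * ((-x₁ : ℤ) : ℂ) * (k : ℝ)) *
        (joukowskiRoot (((Real.cos k - c : ℝ) : ℂ) + ε * Complex.I) ^ x₂.natAbs *
          joukowskiDensity (((Real.cos k - c : ℝ) : ℂ) + ε * Complex.I)) =
      latticeGreen ((e : ℂ) + ε * Complex.I) x₁ x₂ := by
    filter_upwards [self_mem_nhdsWithin] with ε hε
    rw [latticeGreen_eq_integral (by simpa using hε)]
    simp only [heq]
  refine Tendsto.congr' hcongr (Tendsto.const_mul _ ?_)
  obtain ⟨α, h0, h1, h⟩ := exists_fermi_angle hc hc2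
  have hsplit := abs_cos_sub_lt_or_gt h0 h1 h
  have hne : ∀ᵐ k : ℝ, k ∈ Set.uIoc (-Real.pi) Real.pi → |Real.cos k - c| ≠ 1 := by
    have hae : ∀ᵐ k : ℝ, k ∉ ({α, -α} : Set ℝ) := (Set.toFinite _).countable.ae_notMem volume
    filter_upwards [hae] with k hk hk'
    rw [Set.uIoc_of_le (by linarith [Real.pi_pos])] at hk'
    have hkpi : |k| ≤ Real.pi := abs_le.2 ⟨hk'.1.le, hk'.2⟩
    simp only [Set.mem_insert_iff, Set.mem_singleton_iff, not_or] at hk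
    have hkα : |k| ≠ α := fun h => (eq_or_eq_neg_of_abs_eq h).elim hk.1 hk.2
    rcases hkα.lt_or_gt with hlt | hlt <;> rcases hsplit with ⟨ha, hb⟩ | ⟨ha, hb⟩
    · exact (ha k hlt).ne
    · exact (ha k hlt).ne'
    · exact (hb k hlt hkpi).ne'
    · exact (hb k hlt hkpi).ne
  have hne' : ∀ k : ℝ, |Real.cos k - c| ≠ 1 →
      Real.cos k - c + 1 ≠ 0 ∧ Real.cos k - c - 1 ≠ 0 := fun k hk =>
    ⟨fun h => hk (by rw [show Real.cos k - c = -1 by linarith]; norm_num),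
      fun h => hk (by rw [show Real.cos k - c = 1 by linarith]; norm_num)⟩
  have him_eq : ∀ v ε : ℝ, ((v : ℂ) + ε * Complex.I).im = ε := fun v ε => by simp
  have hre_add : ∀ v ε : ℝ, v + 1 = ((v : ℂ) + ε * Complex.I + 1).re := fun v ε => by simp
  have hre_sub : ∀ v ε : ℝ, v - 1 = ((v : ℂ) + ε * Complex.I - 1).re := fun v ε => by simp
  have hm1 := continuous_joukowskiRoot.measurable
  have hm2 := measurable_joukowskiDensity
  refine intervalIntegral.tendsto_integral_filter_of_dominated_convergence (boundaryDensity c)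
    (Eventually.of_forall fun ε => Measurable.aestronglyMeasurable (by fun_prop)) ?_
    (intervalIntegrable_boundaryDensity hc hc2) ?_
  · filter_upwards [self_mem_nhdsWithin] with ε hε
    filter_upwards [hne] with k hk hk'
    obtain ⟨hk1, hk2⟩ := hne' k (hk hk')
    have him : 0 ≤ (((Real.cos k - c : ℝ) : ℂ) + ε * Complex.I).im := by
      rw [him_eq]
      exact (Set.mem_Ioi.1 hε).le
    rw [norm_mul, norm_exp_I_mul_int_mul, one_mul, norm_mul, norm_pow]
    refine (mul_le_of_le_one_left (norm_nonneg _) (pow_le_one₀ (norm_nonneg _)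
      (norm_joukowskiRoot_le_one him))).trans ?_
    rw [norm_joukowskiDensity him, boundaryDensity]
    have := abs_pos.2 hk1
    have := abs_pos.2 hk2
    refine inv_anti₀ (by positivity) (mul_le_mul (Real.sqrt_le_sqrt ?_) (Real.sqrt_le_sqrt ?_)
      (Real.sqrt_nonneg _) (Real.sqrt_nonneg _))
    · rw [hre_add _ ε]
      exact Complex.abs_re_le_norm _
    · rw [hre_sub _ ε]
      exact Complex.abs_re_le_norm _
  · filter_upwards [hne] with k hk hk'
    obtain ⟨hk1, hk2⟩ := hne' k (hk hk')
    have hu : Tendsto (fun ε : ℝ => ((Real.cos k - c : ℝ) : ℂ) + ε * Complex.I) (𝓝[>] 0)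
        (𝓝 ((Real.cos k - c : ℝ) : ℂ)) := by
      have hcont : Continuous fun ε : ℝ => ((Real.cos k - c : ℝ) : ℂ) + ε * Complex.I := by
        fun_prop
      have := hcont.tendsto 0
      simp only [Complex.ofReal_zero, zero_mul, add_zero] at this
      exact this.mono_left nhdsWithin_le_nhds
    refine Tendsto.const_mul _ (Tendsto.mul (Tendsto.pow ?_ _) ?_)
    · exact (continuous_joukowskiRoot.tendsto _).comp hu
    · have hs := continuous_quadrantSqrt
      have hcont : Continuous fun u : ℂ => quadrantSqrt (u + 1) * quadrantSqrt (u - 1) := by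
        fun_prop
      refine ((hcont.tendsto _).comp hu).inv₀ ?_
      have hz : ∀ w : ℝ, w ≠ 0 → quadrantSqrt (w : ℂ) ≠ 0 := fun w hw h => hw (by
        have := quadrantSqrt_sq (u := (w : ℂ)) (by simp)
        rw [h, zero_pow two_ne_zero] at this
        exact_mod_cast this.symm)
      refine mul_ne_zero ?_ ?_
      · exact_mod_cast hz _ hk1
      · exact_mod_cast hz _ hk2

/-! ### Decay of the boundary value -/

open Filter Topology in
/-- Decay of the contribution of momenta off the energy band of the one-dimensional chain. -/
theorem exists_norm_integral_boundaryIntegrand_le_of_one_lt {c p q : ℝ} (hpq : p ≤ q)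
    (hD : IntervalIntegrable (boundaryDensity c) volume p q)
    (hv : ∀ k ∈ Set.Ioo p q, 1 < |Real.cos k - c|) {δ : ℝ} (hδ : 0 < δ) :
    ∃ N : ℕ, ∀ n ≥ N, ∀ m : ℤ, ‖∫ k in p..q, boundaryIntegrand c n m k‖ ≤ δ := by
  have hm := continuous_joukowskiRoot.measurable
  have hlim : Tendsto (fun n : ℕ => ∫ k in p..q,
      ‖joukowskiRoot ((Real.cos k - c : ℝ) : ℂ)‖ ^ n * boundaryDensity c k) atTop (𝓝 0) := by
    have h0 : ∫ _ in p..q, (0 : ℝ) = 0 := by simp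
    rw [← h0]
    refine intervalIntegral.tendsto_integral_filter_of_dominated_convergence (boundaryDensity c)
      (Eventually.of_forall fun n => Measurable.aestronglyMeasurable ?_)
      (Eventually.of_forall fun n => Eventually.of_forall fun k _ => ?_) hD ?_
    · unfold boundaryDensity
      fun_prop
    · rw [← norm_boundaryIntegrand c n 0, norm_norm]
      exact norm_boundaryIntegrand_le c n 0 k
    · have hae : ∀ᵐ k : ℝ, k ∉ ({q} : Set ℝ) := (Set.toFinite _).countable.ae_notMem volume
      filter_upwards [hae] with k hk hk'
      rw [Set.uIoc_of_le hpq] at hk'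
      have hlt := norm_joukowskiRoot_lt_one (u := ((Real.cos k - c : ℝ) : ℂ))
        (Complex.ofReal_im _).ge
        (Or.inr (by
          rw [Complex.ofReal_re]
          exact hv k ⟨hk'.1, lt_of_le_of_ne hk'.2 hk⟩))
      simpa using (tendsto_pow_atTop_nhds_zero_of_lt_one (norm_nonneg _) hlt).mul_const
        (boundaryDensity c k)
  obtain ⟨N, hN⟩ := eventually_atTop.1 (hlim.eventually (ge_mem_nhds hδ))
  refine ⟨N, fun n hn m => le_trans ?_ (hN n hn)⟩
  refine (intervalIntegral.norm_integral_le_integral_norm hpq).trans_eq ?_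
  simp only [norm_boundaryIntegrand]

theorem joukowskiRoot_of_abs_lt_one {v : ℝ} (hv : |v| < 1) :
    joukowskiRoot (v : ℂ) = -Complex.exp (-(Complex.I * (Real.arccos v : ℂ))) ∧
      joukowskiDensity (v : ℂ) = -Complex.I * ((√(1 - v ^ 2))⁻¹ : ℝ) := by
  obtain ⟨h1, h2⟩ := abs_lt.1 hv
  have ha : quadrantSqrt ((v : ℂ) + 1) = (√(1 + v) : ℝ) := by
    have hn : ‖(v : ℂ) + 1‖ = 1 + v := by
      rw [show (v : ℂ) + 1 = ((1 + v : ℝ) : ℂ) by push_cast; ring, Complex.norm_real,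
        Real.norm_of_nonneg (by linarith)]
    apply Complex.ext
    · simp only [quadrantSqrt, hn, Complex.ofReal_re, Complex.add_re, Complex.one_re]
      congr 1
      ring
    · simp only [quadrantSqrt, hn, Complex.ofReal_re, Complex.add_re, Complex.one_re,
        Complex.ofReal_im]
      rw [show (1 + v - (v + 1)) / 2 = 0 by ring, Real.sqrt_zero]
  have hb : quadrantSqrt ((v : ℂ) - 1) = Complex.I * (√(1 - v) : ℝ) := by
    have hn : ‖(v : ℂ) - 1‖ = 1 - v := by
      rw [show (v : ℂ) - 1 = ((v - 1 : ℝ) : ℂ) by push_cast; ring, Complex.norm_real,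
        Real.norm_of_nonpos (by linarith)]
      ring
    apply Complex.ext
    · simp only [quadrantSqrt, hn, Complex.ofReal_re, Complex.sub_re, Complex.one_re,
        Complex.I_mul_re, Complex.ofReal_im, neg_zero]
      rw [show (1 - v + (v - 1)) / 2 = 0 by ring, Real.sqrt_zero]
    · simp only [quadrantSqrt, hn, Complex.ofReal_re, Complex.sub_re, Complex.one_re,
        Complex.I_mul_im]
      congr 1
      ring
  have hab : √(1 + v) * √(1 - v) = √(1 - v ^ 2) := by
    rw [← Real.sqrt_mul (by linarith)]; congr 1; ring
  have hab' : ((√(1 + v) : ℝ) : ℂ) * ((√(1 - v) : ℝ) : ℂ) = ((√(1 - v ^ 2) : ℝ) : ℂ) := by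
    exact_mod_cast hab
  have hsa : ((√(1 + v) : ℝ) : ℂ) ^ 2 = 1 + v := by
    exact_mod_cast Real.sq_sqrt (by linarith : 0 ≤ 1 + v)
  have hsb : ((√(1 - v) : ℝ) : ℂ) ^ 2 = 1 - v := by
    exact_mod_cast Real.sq_sqrt (by linarith : 0 ≤ 1 - v)
  constructor
  · have hexp : Complex.exp (-(Complex.I * (Real.arccos v : ℂ))) =
        (v : ℂ) - ((√(1 - v ^ 2) : ℝ) : ℂ) * Complex.I := by
      rw [show -(Complex.I * (Real.arccos v : ℂ)) = ((-Real.arccos v : ℝ) : ℂ) * Complex.I by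
        push_cast; ring, Complex.exp_mul_I, ← Complex.ofReal_cos, ← Complex.ofReal_sin,
        Real.cos_neg, Real.sin_neg, Real.cos_arccos h1.le h2.le, Real.sin_arccos]
      push_cast
      ring
    rw [hexp, joukowskiRoot, ha, hb, ← hab']
    linear_combination -hsa / 2 + hsb / 2 - ((√(1 - v) : ℝ) : ℂ) ^ 2 / 2 * Complex.I_sq
  · rw [joukowskiDensity, ha, hb, mul_left_comm, hab', mul_inv, Complex.inv_I]
    push_cast
    ring

theorem boundaryIntegrand_of_abs_lt_one {c k : ℝ} (hv : |Real.cos k - c| < 1) (n : ℕ) (m : ℤ) :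
    boundaryIntegrand c n m k = (-1) ^ n * -Complex.I *
      (((√(1 - (Real.cos k - c) ^ 2))⁻¹ : ℝ) *
        Complex.exp (Complex.I * ((-(n * Real.arccos (Real.cos k - c) - m * k) : ℝ) : ℂ))) := by
  obtain ⟨h1, h2⟩ := joukowskiRoot_of_abs_lt_one hv
  have h3 : Complex.exp (Complex.I * ((-(n * Real.arccos (Real.cos k - c) - m * k) : ℝ) : ℂ)) =
      Complex.exp (Complex.I * m * k) *
        Complex.exp (-(Complex.I * (Real.arccos (Real.cos k - c) : ℂ))) ^ n := by
    rw [← Complex.exp_nat_mul, ← Complex.exp_add]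
    congr 1
    push_cast
    ring
  rw [boundaryIntegrand, h1, h2, h3, neg_pow]
  ring

theorem norm_integral_mul_exp_I_neg (A f : ℝ → ℝ) (a b : ℝ) :
    ‖∫ x in a..b, (A x : ℂ) * Complex.exp (Complex.I * ((-f x : ℝ) : ℂ))‖ =
      ‖∫ x in a..b, (A x : ℂ) * Complex.exp (Complex.I * (f x : ℂ))‖ := by
  have h : ∀ x, (A x : ℂ) * Complex.exp (Complex.I * ((-f x : ℝ) : ℂ)) =
      starRingEnd ℂ ((A x : ℂ) * Complex.exp (Complex.I * (f x : ℂ))) := fun x => by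
    rw [map_mul, ← Complex.exp_conj, map_mul, Complex.conj_ofReal, Complex.conj_ofReal,
      Complex.conj_I]
    congr 2
    push_cast
    ring
  simp_rw [h]
  rw [intervalIntegral.intervalIntegral_conj, Complex.norm_conj]

/-- The second derivative of the phase is bounded below by `|c| / 2` inside the band. -/
theorem half_le_curvature {x v : ℝ} (hx : |x| ≤ 1) (hv : |v| < 1) :
    1 / 2 ≤ (1 + x * v) / √(1 - v ^ 2) ^ 3 := by
  obtain ⟨h1, h2⟩ := abs_lt.1 hv
  have hs2 : 0 < 1 - v ^ 2 := by nlinarith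
  have hs := Real.sqrt_pos.2 hs2
  have hsq := Real.sq_sqrt hs2.le
  have hs1 : √(1 - v ^ 2) ≤ 1 := Real.sqrt_le_one.2 (by nlinarith)
  rw [div_le_div_iff₀ two_pos (by positivity), one_mul]
  have h3 : √(1 - v ^ 2) ^ 3 ≤ 1 - v ^ 2 := by
    calc √(1 - v ^ 2) ^ 3 = √(1 - v ^ 2) ^ 2 * √(1 - v ^ 2) := by ring
      _ ≤ √(1 - v ^ 2) ^ 2 * 1 := by gcongr
      _ = 1 - v ^ 2 := by rw [mul_one, hsq]
  have h4 : -|v| ≤ x * v := by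
    have := neg_abs_le (x * v)
    rw [abs_mul] at this
    nlinarith [mul_le_mul_of_nonneg_right hx (abs_nonneg v)]
  have h5 : v ^ 2 = |v| ^ 2 := (sq_abs v).symm
  nlinarith [abs_nonneg v, sq_nonneg (1 - |v|)]

/-- Stationary phase bound on a closed interval of momenta inside the band. -/
theorem exists_norm_integral_boundaryIntegrand_le_div_sqrt {c p q : ℝ} (hc : c ≠ 0) (hpq : p ≤ q)
    (hv : ∀ k ∈ Set.Icc p q, |Real.cos k - c| < 1) :
    ∃ K : ℝ, ∀ n : ℕ, 0 < n → ∀ m : ℤ,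
      ‖∫ k in p..q, boundaryIntegrand c n m k‖ ≤ K * (8 / √(n * (|c| / 2))) := by
  set s : ℝ → ℝ := fun k => √(1 - (Real.cos k - c) ^ 2) with hs
  have hpos : ∀ k ∈ Set.Icc p q, 0 < 1 - (Real.cos k - c) ^ 2 := fun k hk => by
    have := (sq_lt_one_iff_abs_lt_one _).2 (hv k hk)
    linarith
  have hspos : ∀ k ∈ Set.Icc p q, 0 < s k := fun k hk => Real.sqrt_pos.2 (hpos k hk)
  have hsq : ∀ k ∈ Set.Icc p q, s k ^ 2 = 1 - (Real.cos k - c) ^ 2 := fun k hk =>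
    Real.sq_sqrt (hpos k hk).le
  have hscont : Continuous s := by fun_prop
  have hdv : ∀ k, HasDerivAt (fun k => Real.cos k - c) (-Real.sin k) k := fun k =>
    (Real.hasDerivAt_cos k).sub_const c
  have hds : ∀ k ∈ Set.Icc p q, HasDerivAt s ((Real.cos k - c) * Real.sin k / s k) k := by
    intro k hk
    have h := (((hdv k).pow 2).const_sub 1).sqrt (hpos k hk).ne'
    refine h.congr_deriv ?_
    have := (hspos k hk).ne'
    simp only [hs] at this
    simp only [hs, Pi.pow_apply]
    field_simp
    norm_num
    ring
  have hdB : ∀ k ∈ Set.Icc p q, HasDerivAt (fun k => (s k)⁻¹)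
      (-((Real.cos k - c) * Real.sin k / s k) / s k ^ 2) k := fun k hk =>
    (hds k hk).inv (hspos k hk).ne'
  have hdφ : ∀ k ∈ Set.Icc p q,
      HasDerivAt (fun k => Real.arccos (Real.cos k - c)) (Real.sin k * (s k)⁻¹) k := by
    intro k hk
    obtain ⟨h1, h2⟩ := abs_lt.1 (hv k hk)
    refine ((Real.hasDerivAt_arccos h1.ne' h2.ne).comp k (hdv k)).congr_deriv ?_
    simp only [hs, one_div]
    ring
  have hdφ' : ∀ k ∈ Set.Icc p q, HasDerivAt (fun k => Real.sin k * (s k)⁻¹)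
      (c * ((1 + Real.cos k * (Real.cos k - c)) / s k ^ 3)) k := by
    intro k hk
    refine ((Real.hasDerivAt_sin k).mul (hdB k hk)).congr_deriv ?_
    have h1 := (hspos k hk).ne'
    have h2 := hsq k hk
    have h3 := Real.sin_sq k
    field_simp
    rw [h2]
    linear_combination -(Real.cos k - c) * h3
  have hne : ∀ k ∈ Set.Icc p q, s k ≠ 0 := fun k hk => (hspos k hk).ne'
  refine ⟨|(s q)⁻¹| + ∫ k in p..q, |-((Real.cos k - c) * Real.sin k / s k) / s k ^ 2|,
    fun n hn m => ?_⟩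
  have hn' : (0 : ℝ) < n := by exact_mod_cast hn
  have hcn : ∀ σ : ℝ, ContinuousOn
      (fun k => σ * (n * (c * ((1 + Real.cos k * (Real.cos k - c)) / s k ^ 3)))) (Set.Icc p q) := by
    intro σ
    refine continuousOn_const.mul (continuousOn_const.mul (continuousOn_const.mul ?_))
    refine ContinuousOn.div (by fun_prop) (by fun_prop) fun k hk => pow_ne_zero _ (hne k hk)
  have hA' : ContinuousOn (fun k => -((Real.cos k - c) * Real.sin k / s k) / s k ^ 2)
      (Set.Icc p q) := by
    refine ContinuousOn.div (ContinuousOn.neg (ContinuousOn.div (by fun_prop) (by fun_prop) hne))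
      (by fun_prop) fun k hk => pow_ne_zero _ (hne k hk)
  have hmain : ∀ σ : ℝ, σ * c = |c| →
      ‖∫ k in p..q, (((s k)⁻¹ : ℝ) : ℂ) * Complex.exp (Complex.I *
        ((σ * (n * Real.arccos (Real.cos k - c) - m * k) : ℝ) : ℂ))‖ ≤
      (|(s q)⁻¹| + ∫ k in p..q, |-((Real.cos k - c) * Real.sin k / s k) / s k ^ 2|) *
        (8 / √(n * (|c| / 2))) := by
    intro σ hσ
    refine norm_integral_mul_exp_I_le (A := fun k => (s k)⁻¹)
      (A' := fun k => -((Real.cos k - c) * Real.sin k / s k) / s k ^ 2)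
      (f := fun k => σ * (n * Real.arccos (Real.cos k - c) - m * k))
      (f' := fun k => σ * (n * (Real.sin k * (s k)⁻¹) - m))
      (f'' := fun k => σ * (n * (c * ((1 + Real.cos k * (Real.cos k - c)) / s k ^ 3))))
      hpq (by have := abs_pos.2 hc; positivity) (fun k hk => ?_) (fun k hk => ?_) (hcn σ)
      (fun k hk => ?_) hdB hA'
    · simpa using (((hdφ k hk).const_mul (n : ℝ)).sub
        ((hasDerivAt_id k).const_mul (m : ℝ))).const_mul σ
    · exact (((hdφ' k hk).const_mul (n : ℝ)).sub_const (m : ℝ)).const_mul σ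
    · have h1 := half_le_curvature (Real.abs_cos_le_one k) (hv k hk)
      calc (n : ℝ) * (|c| / 2) = n * (|c| * (1 / 2)) := by ring
        _ ≤ n * (|c| * ((1 + Real.cos k * (Real.cos k - c)) / s k ^ 3)) := by gcongr
        _ = _ := by rw [← hσ]; ring
  have hcongr : ∫ k in p..q, boundaryIntegrand c n m k = (-1) ^ n * -Complex.I *
      ∫ k in p..q, (((s k)⁻¹ : ℝ) : ℂ) * Complex.exp (Complex.I *
        ((-(n * Real.arccos (Real.cos k - c) - m * k) : ℝ) : ℂ)) := by
    rw [← intervalIntegral.integral_const_mul]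
    apply intervalIntegral.integral_congr
    intro k hk
    rw [Set.uIcc_of_le hpq] at hk
    exact boundaryIntegrand_of_abs_lt_one (hv k hk) n m
  rw [hcongr, norm_mul, norm_mul, norm_pow, norm_neg, norm_neg, norm_one, one_pow, Complex.norm_I,
    one_mul, one_mul]
  rcases hc.lt_or_gt with h | h
  · simpa using hmain (-1) (by rw [abs_of_neg h]; ring)
  · rw [norm_integral_mul_exp_I_neg (fun k => (s k)⁻¹)
      (fun k => n * Real.arccos (Real.cos k - c) - m * k)]
    simpa using hmain 1 (by rw [abs_of_pos h]; ring)

open Filter Topology in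
/-- Decay of the contribution of momenta in the energy band of the one-dimensional chain. -/
theorem exists_norm_integral_boundaryIntegrand_le_of_lt_one {c p q : ℝ} (hc : c ≠ 0) (hpq : p < q)
    (hD : IntervalIntegrable (boundaryDensity c) volume p q)
    (hv : ∀ k ∈ Set.Ioo p q, |Real.cos k - c| < 1) {δ : ℝ} (hδ : 0 < δ) :
    ∃ N : ℕ, ∀ n ≥ N, ∀ m : ℤ, ‖∫ k in p..q, boundaryIntegrand c n m k‖ ≤ δ := by
  have hsub : ∀ {s t}, s ∈ Set.Icc p q → t ∈ Set.Icc p q →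
      IntervalIntegrable (boundaryDensity c) volume s t := fun {s t} hs ht =>
    hD.mono_set (by
      rw [Set.uIcc_of_le hpq.le]
      exact Set.ordConnected_Icc.uIcc_subset hs ht)
  have hpmem : p ∈ Set.Icc p q := ⟨le_rfl, hpq.le⟩
  have hqmem : q ∈ Set.Icc p q := ⟨hpq.le, le_rfl⟩
  have hcont : ContinuousOn (fun t => ∫ k in p..t, boundaryDensity c k) (Set.Icc p q) := by
    have := intervalIntegral.continuousOn_primitive_interval (a := p) (b := q)
      (f := boundaryDensity c) (μ := volume) (by
        rw [Set.uIcc_of_le hpq.le]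
        exact (intervalIntegrable_iff_integrableOn_Icc_of_le hpq.le).1 hD)
    rwa [Set.uIcc_of_le hpq.le] at this
  obtain ⟨r, hpr, hrq⟩ := exists_between hpq
  obtain ⟨p', hp'1, hp'2⟩ : ∃ p' ∈ Set.Ioo p r, ∫ k in p..p', boundaryDensity c k < δ / 3 := by
    have h := (hcont p hpmem).mono_left (nhdsWithin_mono p
      ((Set.Ioo_subset_Icc_self).trans (Set.Icc_subset_Icc_right hrq.le) :
        Set.Ioo p r ⊆ Set.Icc p q))
    simp only [intervalIntegral.integral_same] at h
    have : (𝓝[Set.Ioo p r] p).NeBot := by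
      rw [nhdsWithin_Ioo_eq_nhdsGT hpr]
      infer_instance
    obtain ⟨t, ht1, ht2⟩ := ((h.eventually (gt_mem_nhds (by positivity : 0 < δ / 3))).and
      self_mem_nhdsWithin).exists
    exact ⟨t, ht2, ht1⟩
  obtain ⟨q', hq'1, hq'2⟩ : ∃ q' ∈ Set.Ioo r q, ∫ k in q'..q, boundaryDensity c k < δ / 3 := by
    have h := (hcont q hqmem).mono_left (nhdsWithin_mono q
      ((Set.Ioo_subset_Icc_self).trans (Set.Icc_subset_Icc_left hpr.le) :
        Set.Ioo r q ⊆ Set.Icc p q))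
    have : (𝓝[Set.Ioo r q] q).NeBot := by
      rw [nhdsWithin_Ioo_eq_nhdsLT hrq]
      infer_instance
    obtain ⟨t, ht1, ht2⟩ := ((h.eventually (lt_mem_nhds
      (sub_lt_self (∫ k in p..q, boundaryDensity c k) (by positivity : 0 < δ / 3)))).and
      self_mem_nhdsWithin).exists
    refine ⟨t, ht2, ?_⟩
    have htmem : t ∈ Set.Icc p q := ⟨(hpr.trans ht2.1).le, ht2.2.le⟩
    have := intervalIntegral.integral_add_adjacent_intervals (hsub hpmem htmem) (hsub htmem hqmem)
    linarith
  have hp'mem : p' ∈ Set.Icc p q := ⟨hp'1.1.le, (hp'1.2.trans hrq).le⟩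
  have hq'mem : q' ∈ Set.Icc p q := ⟨(hpr.trans hq'1.1).le, hq'1.2.le⟩
  have hpq' : p' ≤ q' := (hp'1.2.trans hq'1.1).le
  obtain ⟨K, hK⟩ := exists_norm_integral_boundaryIntegrand_le_div_sqrt hc hpq'
    (fun k hk => hv k ⟨hp'1.1.trans_le hk.1, hk.2.trans_lt hq'1.2⟩)
  have hlim : Tendsto (fun n : ℕ => K * (8 / √(n * (|c| / 2)))) atTop (𝓝 0) := by
    have h1 : Tendsto (fun n : ℕ => √((n : ℝ) * (|c| / 2))) atTop atTop :=
      Real.tendsto_sqrt_atTop.comp (tendsto_natCast_atTop_atTop.atTop_mul_const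
        (half_pos (abs_pos.2 hc)))
    simpa using (h1.const_div_atTop 8).const_mul K
  obtain ⟨N, hN⟩ := eventually_atTop.1
    ((hlim.eventually (ge_mem_nhds (by positivity : 0 < δ / 3))).and (eventually_gt_atTop 0))
  refine ⟨N, fun n hn m => ?_⟩
  obtain ⟨hn1, hn2⟩ := hN n hn
  have hF : ∀ {s t}, s ∈ Set.Icc p q → t ∈ Set.Icc p q →
      IntervalIntegrable (boundaryIntegrand c n m) volume s t := fun hs ht =>
    intervalIntegrable_boundaryIntegrand (hsub hs ht) n m
  have hbd : ∀ {s t}, s ∈ Set.Icc p q → t ∈ Set.Icc p q → s ≤ t →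
      ‖∫ k in s..t, boundaryIntegrand c n m k‖ ≤ ∫ k in s..t, boundaryDensity c k :=
    fun hs ht hst => intervalIntegral.norm_integral_le_of_norm_le hst
      (Eventually.of_forall fun k _ => norm_boundaryIntegrand_le c n m k) (hsub hs ht)
  rw [← intervalIntegral.integral_add_adjacent_intervals (hF hpmem hp'mem) (hF hp'mem hqmem),
    ← intervalIntegral.integral_add_adjacent_intervals (hF hp'mem hq'mem) (hF hq'mem hqmem)]
  have e1 := hbd hpmem hp'mem hp'1.1.le
  have e2 := hbd hq'mem hqmem hq'1.2.le
  have e3 := (hK n hn2 m).trans hn1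
  refine (norm_add_le _ _).trans ?_
  have e4 := norm_add_le (∫ k in p'..q', boundaryIntegrand c n m k)
    (∫ k in q'..q, boundaryIntegrand c n m k)
  linarith

theorem exists_norm_integral_boundaryIntegrand_le {c : ℝ} (hc : c ≠ 0) (hc2 : |c| < 2)
    {δ : ℝ} (hδ : 0 < δ) :
    ∃ N : ℕ, ∀ n ≥ N, ∀ m : ℤ,
      ‖∫ k in (-Real.pi)..Real.pi, boundaryIntegrand c n m k‖ ≤ δ := by
  obtain ⟨α, h0, h1, h⟩ := exists_fermi_angle hc hc2
  have hD := intervalIntegrable_boundaryDensity hc hc2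
  have hpi := Real.pi_pos
  have hsub : ∀ {s t}, s ∈ Set.Icc (-Real.pi) Real.pi → t ∈ Set.Icc (-Real.pi) Real.pi →
      IntervalIntegrable (boundaryDensity c) volume s t := fun {s t} hs ht =>
    hD.mono_set (by
      rw [Set.uIcc_of_le (by linarith : -Real.pi ≤ Real.pi)]
      exact Set.ordConnected_Icc.uIcc_subset hs ht)
  have m1 : -Real.pi ∈ Set.Icc (-Real.pi) Real.pi := ⟨le_rfl, by linarith⟩
  have m2 : -α ∈ Set.Icc (-Real.pi) Real.pi := ⟨by linarith, by linarith⟩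
  have m3 : α ∈ Set.Icc (-Real.pi) Real.pi := ⟨by linarith, by linarith⟩
  have m4 : Real.pi ∈ Set.Icc (-Real.pi) Real.pi := ⟨by linarith, le_rfl⟩
  have hpiece : ∀ {p q : ℝ}, p < q → p ∈ Set.Icc (-Real.pi) Real.pi →
      q ∈ Set.Icc (-Real.pi) Real.pi →
      ((∀ k ∈ Set.Ioo p q, |Real.cos k - c| < 1) ∨ (∀ k ∈ Set.Ioo p q, 1 < |Real.cos k - c|)) →
      ∃ N : ℕ, ∀ n ≥ N, ∀ m : ℤ, ‖∫ k in p..q, boundaryIntegrand c n m k‖ ≤ δ / 3 := by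
    intro p q hpq hp hq hor
    rcases hor with hv | hv
    · exact exists_norm_integral_boundaryIntegrand_le_of_lt_one hc hpq (hsub hp hq) hv
        (by positivity)
    · exact exists_norm_integral_boundaryIntegrand_le_of_one_lt hpq.le (hsub hp hq) hv
        (by positivity)
  have hsplit := abs_cos_sub_lt_or_gt h0 h1 h
  have i1 : ∀ k ∈ Set.Ioo (-Real.pi) (-α), α < |k| ∧ |k| ≤ Real.pi := fun k hk => by
    rw [abs_of_neg (by linarith [hk.2])]
    constructor <;> linarith [hk.1, hk.2]
  have i2 : ∀ k ∈ Set.Ioo (-α) α, |k| < α := fun k hk => abs_lt.2 hk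
  have i3 : ∀ k ∈ Set.Ioo α Real.pi, α < |k| ∧ |k| ≤ Real.pi := fun k hk => by
    rw [abs_of_pos (by linarith [hk.1])]
    exact ⟨hk.1, hk.2.le⟩
  obtain ⟨N₁, hN₁⟩ := hpiece (by linarith) m1 m2 (by
    rcases hsplit with ⟨_, hb⟩ | ⟨_, hb⟩
    · exact Or.inr fun k hk => hb k (i1 k hk).1 (i1 k hk).2
    · exact Or.inl fun k hk => hb k (i1 k hk).1 (i1 k hk).2)
  obtain ⟨N₂, hN₂⟩ := hpiece (by linarith) m2 m3 (by
    rcases hsplit with ⟨ha, _⟩ | ⟨ha, _⟩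
    · exact Or.inl fun k hk => ha k (i2 k hk)
    · exact Or.inr fun k hk => ha k (i2 k hk))
  obtain ⟨N₃, hN₃⟩ := hpiece h1 m3 m4 (by
    rcases hsplit with ⟨_, hb⟩ | ⟨_, hb⟩
    · exact Or.inr fun k hk => hb k (i3 k hk).1 (i3 k hk).2
    · exact Or.inl fun k hk => hb k (i3 k hk).1 (i3 k hk).2)
  refine ⟨max N₁ (max N₂ N₃), fun n hn m => ?_⟩
  simp only [ge_iff_le, max_le_iff] at hn
  have hF : ∀ {s t}, s ∈ Set.Icc (-Real.pi) Real.pi → t ∈ Set.Icc (-Real.pi) Real.pi →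
      IntervalIntegrable (boundaryIntegrand c n m) volume s t := fun hs ht =>
    intervalIntegrable_boundaryIntegrand (hsub hs ht) n m
  rw [← intervalIntegral.integral_add_adjacent_intervals (hF m1 m2) (hF m2 m4),
    ← intervalIntegral.integral_add_adjacent_intervals (hF m2 m3) (hF m3 m4)]
  have e1 := hN₁ n hn.1 m
  have e2 := hN₂ n hn.2.1 m
  have e3 := hN₃ n hn.2.2 m
  refine (norm_add_le _ _).trans ?_
  have e4 := norm_add_le (∫ k in (-α)..α, boundaryIntegrand c n m k)
    (∫ k in α..Real.pi, boundaryIntegrand c n m k)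
  linarith

open Filter Topology in
/-- The boundary value `g₊(e;·)` of the lattice Green's function tends to zero at
infinity on the lattice. -/
theorem latticeGreen_boundary_tendsto_zero
    (gp : ℝ → ℤ → ℤ → ℂ)
    (hgp : ∀ e ∈ Set.Ioo (0 : ℝ) 4, e ≠ 2 → ∀ x₁ x₂ : ℤ,
      Tendsto (fun ε : ℝ => latticeGreen ((e : ℂ) + ε * Complex.I) x₁ x₂)
        (𝓝[>] 0) (𝓝 (gp e x₁ x₂)))
    (e : ℝ) (he : e ∈ Set.Ioo (0 : ℝ) 4) (he2 : e ≠ 2) :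
    Tendsto (fun x : ℤ × ℤ => gp e x.1 x.2) Filter.cofinite (𝓝 0) := by
  have hc : 2 - e ≠ 0 := fun h => he2 (by linarith)
  have hc2 : |2 - e| < 2 := by rw [abs_lt]; constructor <;> linarith [he.1, he.2]
  have hval : ∀ x₁ x₂, gp e x₁ x₂ = -(2 * (Real.pi : ℂ))⁻¹ * ∫ k in (-Real.pi)..Real.pi,
      boundaryIntegrand (2 - e) x₂.natAbs (-x₁) k := fun x₁ x₂ =>
    tendsto_nhds_unique (hgp e he he2 x₁ x₂) (tendsto_latticeGreen he he2 x₁ x₂)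
  have hswap : ∀ x₁ x₂, gp e x₁ x₂ = gp e x₂ x₁ := fun x₁ x₂ => by
    refine tendsto_nhds_unique (hgp e he he2 x₁ x₂) ?_
    simpa only [latticeGreen_swap _ x₁ x₂] using hgp e he he2 x₂ x₁
  rw [Metric.tendsto_nhds]
  intro δ hδ
  obtain ⟨N, hN⟩ := exists_norm_integral_boundaryIntegrand_le hc hc2 hδ
  have hsmall : ∀ x₁ x₂ : ℤ, N ≤ x₂.natAbs → ‖gp e x₁ x₂‖ < δ := by
    intro x₁ x₂ hx
    rw [hval, norm_mul, norm_neg, norm_inv, norm_mul, Complex.norm_ofNat, Complex.norm_real,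
      Real.norm_of_nonneg Real.pi_pos.le]
    have h1 : (2 * Real.pi)⁻¹ < 1 := inv_lt_one_of_one_lt₀ (by linarith [Real.pi_gt_three])
    have h2 := hN _ hx (-x₁)
    have h3 : 0 < (2 * Real.pi)⁻¹ := by have := Real.pi_pos; positivity
    calc _ ≤ (2 * Real.pi)⁻¹ * δ := by gcongr
      _ < 1 * δ := by gcongr
      _ = δ := one_mul δ
  rw [Filter.eventually_cofinite]
  refine Set.Finite.subset ((Set.finite_Icc (-(N : ℤ)) N).prod (Set.finite_Icc (-(N : ℤ)) N)) ?_
  rintro ⟨x₁, x₂⟩ hx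
  simp only [dist_zero_right, Set.mem_ofPred_eq] at hx
  have a1 : ¬ N ≤ x₂.natAbs := fun h => hx (hsmall x₁ x₂ h)
  have a2 : ¬ N ≤ x₁.natAbs := fun h => hx (hswap x₁ x₂ ▸ hsmall x₂ x₁ h)
  simp only [Set.mem_prod, Set.mem_Icc]
  omega
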